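/- Let 2 ≤ m < n be integers and let BS(m,n) = ⟨a,t | t aᵐ t⁻¹ = aⁿ⟩ be the Baumslag–Solitar group. Then BS(m,n) is blind deterministic 3-counter-graph automatic: there exist a finite alphabet Λ and a normal form L ⊆ Λ* accepted by a deterministic quasi-realtime blind counter automaton with at most 3 counters, such that for each generator x ∈ {a, a⁻¹, t, t⁻¹} the multiplier language L_x is accepted by a deterministic quasi-realtime blind counter automaton with at most 3 counters. -/

import Mathlib

/-- A transition of a `k`-counter automaton with state set `Q` over alphabet `α`.
It reads `input` (`none` meaning an ε-transition), and for each counter it may be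
guarded (`guard i = some true`: counter `i` must be zero; `guard i = some false`:
counter `i` must be nonzero; `guard i = none`: no test), it adds `add i` to counter `i`,
and if `reset i = true` it sets counter `i` to zero. -/
structure CTrans (α Q : Type) (k : ℕ) where
  src : Q
  tgt : Q
  input : Option α
  add : Fin k → ℤ
  guard : Fin k → Option Bool
  reset : Fin k → Bool

/-- A nondeterministic `k`-counter automaton over the alphabet `α`: a finite state set
with an initial state, accept states, and finitely many transitions. -/
structure CAuto (α : Type) (k : ℕ) where
  Q : Type
  [fintypeQ : Fintype Q]
  start : Q
  accept : Q → Bool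
  trans : List (CTrans α Q k)

namespace CAuto

variable {α : Type} {k : ℕ}

/-- The guard of a transition is satisfied by the counter values `c`. -/
def GuardOK {Q : Type} (t : CTrans α Q k) (c : Fin k → ℤ) : Prop :=
  ∀ i, (t.guard i = some true → c i = 0) ∧ (t.guard i = some false → c i ≠ 0)

/-- The effect of a transition on the counter values. -/
def applyC {Q : Type} (t : CTrans α Q k) (c : Fin k → ℤ) : Fin k → ℤ :=
  fun i => if t.reset i then 0 else c i + t.add i

/-- `M.Valid c ts c'` : the list of transitions `ts` is a valid computation path
of `M` from the configuration `c` to the configuration `c'`. -/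
def Valid (M : CAuto α k) : M.Q × (Fin k → ℤ) → List (CTrans α M.Q k) → M.Q × (Fin k → ℤ) → Prop
  | c, [], c' => c = c'
  | c, t :: ts, c' =>
      t ∈ M.trans ∧ t.src = c.1 ∧ GuardOK t c.2 ∧ M.Valid (t.tgt, applyC t c.2) ts c'

/-- The word read along a computation path (ε-transitions read nothing). -/
def word {Q : Type} (ts : List (CTrans α Q k)) : List α := ts.filterMap (·.input)

/-- The initial configuration: the start state with all counters zero. -/
def startConfig (M : CAuto α k) : M.Q × (Fin k → ℤ) := (M.start, fun _ => 0)

/-- `M` accepts `w` if some computation path reading `w` leads from the initial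
configuration to an accept state with all counters equal to `0`. -/
def Accepts (M : CAuto α k) (w : List α) : Prop :=
  ∃ ts q, M.Valid M.startConfig ts (q, fun _ => 0) ∧ M.accept q = true ∧ word ts = w

/-- The language accepted by `M`. -/
def lang (M : CAuto α k) : Language α := { w | M.Accepts w }

/-- A blind automaton has no guards and no resets. -/
def Blind (M : CAuto α k) : Prop :=
  ∀ t ∈ M.trans, (∀ i, t.guard i = none) ∧ (∀ i, t.reset i = false)

/-- `M` runs in quasi-realtime: there is a uniform bound on the number of consecutive
ε-transitions along any computation path. -/
def QuasiRealtime (M : CAuto α k) : Prop :=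
  ∃ B : ℕ, ∀ ts c, M.Valid M.startConfig ts c →
    ∀ l₁ l₂ l₃, ts = l₁ ++ l₂ ++ l₃ → (∀ t ∈ l₂, t.input = none) → l₂.length ≤ B

/-- `M` is deterministic: it has no ε-transitions and from each configuration at most one
transition applies to each input letter. -/
def Deterministic (M : CAuto α k) : Prop :=
  (∀ t ∈ M.trans, t.input ≠ none) ∧
    ∀ t₁ ∈ M.trans, ∀ t₂ ∈ M.trans, t₁.src = t₂.src → t₁.input = t₂.input →
      ∀ c : Fin k → ℤ, GuardOK t₁ c → GuardOK t₂ c → t₁ = t₂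

end CAuto

/-- The convolution of two words `u ∈ A*`, `v ∈ B*`: the word of length
`max |u| |v|` over `Option A × Option B` (with `none` playing the role of the
padding symbol ⋄) whose `i`-th letter is the pair of the `i`-th letters of `u`
and `v`, padded with `none`. -/
def conv {A B : Type} (u : List A) (v : List B) : List (Option A × Option B) :=
  (List.range (max u.length v.length)).map fun i => (u[i]?, v[i]?)

/-- The multiplier language `L_x` of a normal form `nf : L → G` for the
group element `x`: all convolutions `⊗(u,v)` with `u, v ∈ L` and `ū x = v̄`. -/
def Mult {Λ G : Type} [Group G] (nf : List Λ → G) (L : Language Λ) (x : G) :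
    Language (Option Λ × Option Λ) :=
  { w | ∃ u ∈ L, ∃ v ∈ L, nf u * x = nf v ∧ w = conv u v }

/-- The word length (geodesic length) `‖g‖_X` of `g` with respect to a generating set
`X ⊆ G`: the minimal length of a word over `X` whose product is `g`. -/
noncomputable def wordLength {G : Type} [Group G] (X : Set G) (g : G) : ℕ :=
  sInf { n | ∃ w : List G, (∀ a ∈ w, a ∈ X) ∧ w.length = n ∧ w.prod = g }

/-- A language is regular if it is accepted by a deterministic finite automaton
with finitely many states. -/
def IsRegLang {α : Type} (L : Language α) : Prop :=
  ∃ (σ : Type) (_ : Fintype σ) (M : DFA α σ), M.accepts = L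

/-- A class of formal languages: an assignment of a set of languages to each alphabet. -/
def LangClass : Type 1 := (α : Type) → Set (Language α)

/-- The image of a language under the monoid homomorphism `α* → β*` induced by
`f : α → List β`. -/
def homImage {α β : Type} (f : α → List β) (L : Language α) : Language β :=
  { w | ∃ u ∈ L, w = (u.map f).flatten }

/-- The preimage of a language under the monoid homomorphism `α* → β*` induced by
`f : α → List β`. -/
def homPreimage {α β : Type} (f : α → List β) (L : Language β) : Language α :=
  { u | (u.map f).flatten ∈ L }

/-- `C` is closed under homomorphism. -/
def ClosedUnderHom (C : LangClass) : Prop :=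
  ∀ (α β : Type) [Fintype α] [Fintype β], ∀ L ∈ C α, ∀ f : α → List β, homImage f L ∈ C β

/-- `C` is closed under ε-free homomorphism. -/
def ClosedUnderEpsFreeHom (C : LangClass) : Prop :=
  ∀ (α β : Type) [Fintype α] [Fintype β], ∀ L ∈ C α, ∀ f : α → List β,
    (∀ a, f a ≠ []) → homImage f L ∈ C β

/-- `C` is closed under inverse homomorphism. -/
def ClosedUnderInvHom (C : LangClass) : Prop :=
  ∀ (α β : Type) [Fintype α] [Fintype β], ∀ L ∈ C β, ∀ f : α → List β, homPreimage f L ∈ C α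

/-- `C` is closed under (finite) intersection. -/
def ClosedUnderInter (C : LangClass) : Prop :=
  ∀ (α : Type) [Fintype α], ∀ L₁ ∈ C α, ∀ L₂ ∈ C α, L₁ ⊓ L₂ ∈ C α

/-- `C` is closed under intersection with regular languages. -/
def ClosedUnderInterReg (C : LangClass) : Prop :=
  ∀ (α : Type) [Fintype α], ∀ L ∈ C α, ∀ R : Language α, IsRegLang R → L ⊓ R ∈ C α

/-- `C` contains all regular languages. -/
def ContainsRegular (C : LangClass) : Prop :=
  ∀ (α : Type) [Fintype α], ∀ L : Language α, IsRegLang L → L ∈ C α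

/-- `(G,X,Λ)` is `C`-graph automatic via the normal form `L ⊆ Λ*` with bijection
`nf : L → G`: `L ∈ C`, `nf` restricted to `L` is a bijection onto `G`, and every
multiplier language `L_x`, `x ∈ X`, is in `C`. -/
def CGraphAutoWith (C : LangClass) {G : Type} [Group G] (X : Set G) {Λ : Type} [Fintype Λ]
    (L : Language Λ) (nf : List Λ → G) : Prop :=
  Set.BijOn nf L Set.univ ∧ L ∈ C Λ ∧ ∀ x ∈ X, Mult nf L x ∈ C (Option Λ × Option Λ)

/-- The single relator `t aᵐ t⁻¹ a⁻ⁿ` of the Baumslag–Solitar group, in the free group on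
two generators (`0` standing for `a` and `1` for `t`). -/
def bsRel (m n : ℕ) : Set (FreeGroup (Fin 2)) :=
  { FreeGroup.of 1 * FreeGroup.of 0 ^ m * (FreeGroup.of 1)⁻¹ * (FreeGroup.of 0 ^ n)⁻¹ }

/-- The Baumslag–Solitar group `BS(m,n) = ⟨a,t ∣ t aᵐ t⁻¹ = aⁿ⟩`. -/
abbrev BS (m n : ℕ) : Type := PresentedGroup (bsRel m n)

/-- The generator `a` of `BS(m,n)`. -/
def bsA (m n : ℕ) : BS m n := PresentedGroup.of 0

/-- The generator `t` of `BS(m,n)`. -/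
def bsT (m n : ℕ) : BS m n := PresentedGroup.of 1

/-- A language is accepted by a deterministic quasi-realtime blind counter automaton with
at most `3` counters. -/
def BlindDetAtMostThreeCounter {α : Type} (L : Language α) : Prop :=
  ∃ k ≤ 3, ∃ M : CAuto α k, M.Blind ∧ M.Deterministic ∧ M.QuasiRealtime ∧ M.lang = L

section WeightedDFA

variable {α σ : Type} {k : ℕ}

/-- The blind counter automaton simulating the deterministic automaton `M`. After reading a
nonempty word `w` its counters hold the total weight of `w` minus the value of `f` at the state
reached by `M`; the extra state `none` is the initial one. -/
noncomputable abbrev weightedAuto [Fintype α] [Fintype σ] (M : DFA α σ) (wt : α → Fin k → ℤ)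
    (f : σ → Fin k → ℤ) : CAuto α k :=
  open Classical in
  { Q := Option σ
    start := none
    accept := fun q => decide (q.getD M.start ∈ M.accept ∧ (q = none → f M.start = 0))
    trans := (Finset.univ : Finset (Option σ × α)).toList.map fun p =>
      { src := p.1
        tgt := some (M.step (p.1.getD M.start) p.2)
        input := some p.2
        add := wt p.2 - f (M.step (p.1.getD M.start) p.2) + p.1.elim 0 f
        guard := fun _ => none
        reset := fun _ => false } }

/-- The only run of `weightedAuto M wt f` on the word `w` from the state `q`. -/
def weightedRun (M : DFA α σ) (wt : α → Fin k → ℤ) (f : σ → Fin k → ℤ) :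
    Option σ → List α → List (CTrans α (Option σ) k)
  | _, [] => []
  | q, a :: w =>
      { src := q
        tgt := some (M.step (q.getD M.start) a)
        input := some a
        add := wt a - f (M.step (q.getD M.start) a) + q.elim 0 f
        guard := fun _ => none
        reset := fun _ => false } :: weightedRun M wt f (some (M.step (q.getD M.start) a)) w

/-- The state of `weightedAuto M wt f` after reading `w` from the state `q`. -/
def weightedState (M : DFA α σ) : Option σ → List α → Option σ
  | q, [] => q
  | q, a :: w => weightedState M (some (M.step (q.getD M.start) a)) w

theorem weightedState_getD (M : DFA α σ) (q : Option σ) (w : List α) :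
    (weightedState M q w).getD M.start = M.evalFrom (q.getD M.start) w := by
  induction w generalizing q with
  | nil => rfl
  | cons a w ih => simp [weightedState, ih]

theorem weightedState_none_eq_none_iff (M : DFA α σ) (w : List α) :
    weightedState M none w = none ↔ w = [] := by
  have key : ∀ (w : List α) (q : σ), weightedState M (some q) w ≠ none := by
    intro w
    induction w with
    | nil => simp [weightedState]
    | cons a w ih => intro q; exact ih _
  cases w with
  | nil => simp [weightedState]
  | cons a w => simpa [weightedState] using key w _

theorem word_weightedRun (M : DFA α σ) (wt : α → Fin k → ℤ) (f : σ → Fin k → ℤ)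
    (q : Option σ) (w : List α) : CAuto.word (weightedRun M wt f q w) = w := by
  induction w generalizing q with
  | nil => rfl
  | cons a w ih =>
    have := ih (some (M.step (q.getD M.start) a))
    simp only [CAuto.word] at this
    simp [weightedRun, CAuto.word, this]

theorem mem_weightedAuto_trans [Fintype α] [Fintype σ] (M : DFA α σ) (wt : α → Fin k → ℤ)
    (f : σ → Fin k → ℤ) (t : CTrans α (Option σ) k) :
    t ∈ (weightedAuto M wt f).trans ↔ ∃ a, t =
      { src := t.src
        tgt := some (M.step (t.src.getD M.start) a)
        input := some a
        add := wt a - f (M.step (t.src.getD M.start) a) + t.src.elim 0 f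
        guard := fun _ => none
        reset := fun _ => false } := by
  simp only [List.mem_map, Finset.mem_toList, Finset.mem_univ, true_and]
  constructor
  · rintro ⟨⟨q, a⟩, rfl⟩
    exact ⟨a, rfl⟩
  · rintro ⟨a, h⟩
    exact ⟨(t.src, a), h.symm⟩

theorem valid_weightedAuto_iff [Fintype α] [Fintype σ] (M : DFA α σ) (wt : α → Fin k → ℤ)
    (f : σ → Fin k → ℤ) (q : Option σ) (c : Fin k → ℤ) (ts : List (CTrans α (Option σ) k))
    (d : Option σ × (Fin k → ℤ)) :
    (weightedAuto M wt f).Valid (q, c) ts d ↔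
      ts = weightedRun M wt f q (CAuto.word ts) ∧
      d = (weightedState M q (CAuto.word ts), c + ((CAuto.word ts).map wt).sum
        - (weightedState M q (CAuto.word ts)).elim 0 f + q.elim 0 f) := by
  induction ts generalizing q c with
  | nil =>
    simp only [CAuto.Valid, CAuto.word, List.filterMap_nil, weightedRun, weightedState,
      List.map_nil, List.sum_nil, add_zero, sub_add_cancel, true_and]
    exact eq_comm
  | cons t ts ih =>
    have hcons : ∀ a, t.input = some a → CAuto.word (t :: ts) = a :: CAuto.word ts := by
      intro a ha
      simp [CAuto.word, ha]
    constructor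
    · rintro ⟨ht, hsrc, -, hv⟩
      obtain ⟨a, hta⟩ := (mem_weightedAuto_trans M wt f t).1 ht
      obtain rfl : t.src = q := hsrc
      have hin : t.input = some a := by rw [hta]
      have htgt : t.tgt = some (M.step (t.src.getD M.start) a) := by rw [hta]
      have hap : CAuto.applyC t c = c +
          (wt a - f (M.step (t.src.getD M.start) a) + t.src.elim 0 f) := by
        rw [hta]; funext i; simp [CAuto.applyC]
      obtain ⟨h1, h2⟩ := (ih _ _).1 hv
      rw [hcons a hin]
      rw [htgt] at h1 h2
      refine ⟨?_, ?_⟩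
      · rw [weightedRun, ← h1, ← hta]
      · rw [h2, hap, weightedState, List.map_cons, List.sum_cons]
        refine Prod.ext rfl ?_
        simp only [Option.elim_some]
        abel
    · rintro ⟨h1, h2⟩
      cases hin : t.input with
      | none =>
        exfalso
        have hw : CAuto.word (t :: ts) = CAuto.word ts := by simp [CAuto.word, hin]
        rw [hw] at h1
        cases hw' : CAuto.word ts with
        | nil => simp [hw', weightedRun] at h1
        | cons a w =>
          rw [hw', weightedRun] at h1
          have := congrArg CTrans.input (List.cons.inj h1).1
          simp [hin] at this
      | some a =>
        rw [hcons a hin, weightedRun] at h1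
        obtain ⟨hta, hts⟩ := List.cons.inj h1
        have hsrc : t.src = q := by rw [hta]
        subst hsrc
        have htgt : t.tgt = some (M.step (t.src.getD M.start) a) := by rw [hta]
        have hap : CAuto.applyC t c = c +
            (wt a - f (M.step (t.src.getD M.start) a) + t.src.elim 0 f) := by
          rw [hta]; funext i; simp [CAuto.applyC]
        refine ⟨(mem_weightedAuto_trans M wt f t).2 ⟨a, hta⟩, rfl, ?_, (ih _ _).2 ⟨?_, ?_⟩⟩
        · rw [hta]; intro i; simp
        · rw [htgt]; exact hts
        · rw [h2, hcons a hin, hap, htgt, weightedState, List.map_cons, List.sum_cons]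
          refine Prod.ext rfl ?_
          simp only [Option.elim_some]
          abel

/-- The words accepted by a deterministic finite automaton whose total weight is the value
prescribed by the final state form a deterministic blind counter language. -/
theorem blindDet_of_dfa [Fintype α] [Fintype σ] (hk : k ≤ 3) (M : DFA α σ)
    (wt : α → Fin k → ℤ) (f : σ → Fin k → ℤ) :
    BlindDetAtMostThreeCounter
      ({w | M.eval w ∈ M.accept ∧ (w.map wt).sum = f (M.eval w)} : Language α) := by
  refine ⟨k, hk, weightedAuto M wt f, ?_, ⟨?_, ?_⟩, ⟨0, ?_⟩, ?_⟩
  · intro t ht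
    obtain ⟨a, h⟩ := (mem_weightedAuto_trans M wt f t).1 ht
    rw [h]
    simp
  · intro t ht
    obtain ⟨a, h⟩ := (mem_weightedAuto_trans M wt f t).1 ht
    rw [h]
    simp
  · intro t₁ h₁ t₂ h₂ hs hi _ _ _
    obtain ⟨a, h⟩ := (mem_weightedAuto_trans M wt f t₁).1 h₁
    obtain ⟨b, h'⟩ := (mem_weightedAuto_trans M wt f t₂).1 h₂
    have ha : t₁.input = some a := by rw [h]
    have hb : t₂.input = some b := by rw [h']
    have hab : a = b := by simpa [ha, hb] using hi
    rw [h, h', hs, hab]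
  · rintro ts c hv l₁ l₂ l₃ rfl hl
    have hmem : ∀ (ts : List (CTrans α (Option σ) k)) c d,
        (weightedAuto M wt f).Valid c ts d → ∀ t ∈ ts, t.input ≠ none := by
      intro ts
      induction ts with
      | nil => simp
      | cons t ts ih =>
        rintro c d ⟨ht, -, -, hv⟩ t' ht'
        rcases List.mem_cons.1 ht' with rfl | h
        · obtain ⟨a, h⟩ := (mem_weightedAuto_trans M wt f _).1 ht
          rw [h]
          simp
        · exact ih _ _ hv _ h
    cases l₂ with
    | nil => simp
    | cons t l =>
      exact absurd (hl t (by simp)) (hmem _ _ _ hv t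
        (List.mem_append_left _ (List.mem_append_right _ List.mem_cons_self)))
  · ext w
    have hacc : (weightedAuto M wt f).Accepts w ↔
        ((weightedState M none w).getD M.start ∈ M.accept ∧
          (weightedState M none w = none → f M.start = 0)) ∧
          (w.map wt).sum = (weightedState M none w).elim 0 f := by
      constructor
      · rintro ⟨ts, q, hv, hq, rfl⟩
        obtain ⟨-, h2⟩ := (valid_weightedAuto_iff M wt f none 0 ts _).1 hv
        obtain ⟨rfl, h3⟩ := Prod.mk.inj h2
        refine ⟨by simpa [weightedAuto] using hq, ?_⟩
        have h4 := h3.symm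
        simp only [Option.elim_none, add_zero, zero_add] at h4
        exact sub_eq_zero.1 h4
      · rintro ⟨h1, h2⟩
        refine ⟨weightedRun M wt f none w, weightedState M none w, ?_, ?_, word_weightedRun ..⟩
        · refine (valid_weightedAuto_iff M wt f none 0 _ _).2 ⟨?_, ?_⟩
          · rw [word_weightedRun]
          · rw [word_weightedRun, h2]
            simp
            rfl
        · simpa [weightedAuto] using h1
    change (weightedAuto M wt f).Accepts w ↔ M.eval w ∈ M.accept ∧ (w.map wt).sum = f (M.eval w)
    rw [hacc, weightedState_getD, weightedState_none_eq_none_iff]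
    cases w with
    | nil => simp [weightedState, DFA.eval, eq_comm]
    | cons a w =>
      have hne : weightedState M none (a :: w) ≠ none := by
        simp [weightedState_none_eq_none_iff]
      obtain ⟨q, hq⟩ := Option.ne_none_iff_exists'.1 hne
      have hev := weightedState_getD M none (a :: w)
      rw [hq] at hev ⊢
      simp only [Option.getD_some, Option.getD_none] at hev
      simp [DFA.eval, hev]

/-- A finite family of regular languages, each cut down by a prescribed total weight, has a
deterministic blind counter language as union, as long as the weight prescribed for an accepted
word is unambiguous. -/
theorem blindDet_of_regular {ι : Type} [Fintype α] [Fintype ι] (hk : k ≤ 3) (R : ι → Language α)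
    (hR : ∀ i, (R i).IsRegular) (wt : α → Fin k → ℤ) (c : ι → Fin k → ℤ)
    (hc : ∀ w i j, w ∈ R i → (w.map wt).sum = c i → w ∈ R j → c j = c i) :
    BlindDetAtMostThreeCounter ({w | ∃ i, w ∈ R i ∧ (w.map wt).sum = c i} : Language α) := by
  classical
  choose σ hσ M hM using hR
  let N : DFA α (∀ i, σ i) :=
    { step := fun q a i => (M i).step (q i) a
      start := fun i => (M i).start
      accept := {q | ∃ i, q i ∈ (M i).accept} }
  have hN : ∀ w i, N.eval w i = (M i).eval w := by
    intro w i
    induction w using List.reverseRecOn with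
    | nil => rfl
    | append_singleton w a ih => simp [N, ← ih]
  have hmem : ∀ w i, w ∈ R i ↔ N.eval w i ∈ (M i).accept := by
    intro w i
    rw [← hM i, hN]
    rfl
  let f : (∀ i, σ i) → Fin k → ℤ := fun q =>
    if h : ∃ i, q i ∈ (M i).accept then c h.choose else 0
  refine Eq.subst (motive := BlindDetAtMostThreeCounter) (Set.ext fun w => Iff.symm ?_)
    (blindDet_of_dfa hk N wt f)
  change (∃ i, w ∈ R i ∧ (w.map wt).sum = c i) ↔
    (∃ i, N.eval w i ∈ (M i).accept) ∧ (w.map wt).sum = f (N.eval w)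
  constructor
  · rintro ⟨i, hi, hs⟩
    have h : ∃ i, N.eval w i ∈ (M i).accept := ⟨i, (hmem w i).1 hi⟩
    refine ⟨h, ?_⟩
    simp only [f, dif_pos h]
    rw [hc w i _ hi hs ((hmem w _).2 h.choose_spec), hs]
  · rintro ⟨h, hs⟩
    simp only [f, dif_pos h] at hs
    exact ⟨h.choose, (hmem w _).2 h.choose_spec, hs⟩

end WeightedDFA

section Regular

variable {α β : Type}

theorem isRegular_isChain [Fintype α] (R : α → α → Prop) :
    Language.IsRegular ({w | w.IsChain R} : Language α) := by
  classical
  let M : DFA α (Option (Option α)) :=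
    { step := fun q a => q.bind fun l => if ∀ x ∈ l, R x a then some (some a) else none
      start := some none
      accept := {q | q ≠ none} }
  have hM : ∀ w : List α, M.eval w = if w.IsChain R then some w.getLast? else none := by
    intro w
    induction w using List.reverseRecOn with
    | nil => simp [M]
    | append_singleton w a ih =>
      rw [DFA.eval_append_singleton, ih]
      by_cases h : w.IsChain R <;> simp [M, h, List.isChain_append]
  refine ⟨_, inferInstance, M, ?_⟩
  ext w
  rw [DFA.mem_accepts, hM]
  change _ ↔ w.IsChain R
  by_cases h : w.IsChain R <;> simp [M, h]

theorem isRegular_foldl {σ : Type} [Fintype σ] (step : σ → α → σ) (s : σ) (A : Set σ) :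
    Language.IsRegular ({w | w.foldl step s ∈ A} : Language α) :=
  ⟨σ, inferInstance, ⟨step, s, A⟩, rfl⟩

theorem isRegular_forall_mem (p : α → Prop) :
    Language.IsRegular ({w | ∀ a ∈ w, p a} : Language α) := by
  classical
  have key : ∀ (w : List α) (b : Bool),
      w.foldl (fun b a => b && decide (p a)) b = true ↔ b = true ∧ ∀ a ∈ w, p a := by
    intro w
    induction w with
    | nil => simp
    | cons a w ih => intro b; simp [ih, and_assoc]
  refine Eq.subst (motive := Language.IsRegular) (Set.ext fun w => Iff.symm ?_)
    (isRegular_foldl (fun b a => b && decide (p a)) true {true})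
  exact (by simpa using (key w true).symm)

theorem isRegular_modEq (d : ℕ) [NeZero d] (g : α → ℤ) (c : ℤ) :
    Language.IsRegular ({w | (w.map g).sum ≡ c [ZMOD d]} : Language α) := by
  have key : ∀ (w : List α) (b : ZMod d),
      w.foldl (fun b a => b + (g a : ZMod d)) b = b + ((w.map g).sum : ℤ) := by
    intro w
    induction w with
    | nil => simp
    | cons a w ih => intro b; simp [ih, add_assoc]
  refine Eq.subst (motive := Language.IsRegular) (Set.ext fun w => Iff.symm ?_)
    (isRegular_foldl (fun b a => b + (g a : ZMod d)) 0 {(c : ZMod d)})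
  change _ ↔ _ = _
  rw [key, zero_add, ZMod.intCast_eq_intCast_iff]
  rfl

theorem isRegular_filterMap_preimage {K : Language β} (hK : K.IsRegular) (g : α → Option β) :
    Language.IsRegular ({w | w.filterMap g ∈ K} : Language α) := by
  obtain ⟨σ, _, M, rfl⟩ := hK
  let N : DFA α σ :=
    { step := fun q a => (g a).elim q (M.step q)
      start := M.start
      accept := M.accept }
  have hN : ∀ w, N.eval w = M.eval (w.filterMap g) := by
    intro w
    induction w using List.reverseRecOn with
    | nil => rfl
    | append_singleton w a ih =>
      rw [DFA.eval_append_singleton, ih]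
      cases h : g a <;> simp [N, h]
  refine ⟨σ, inferInstance, N, ?_⟩
  ext w
  rw [DFA.mem_accepts, hN]
  rfl

end Regular

section Convolution

variable {A B : Type}

@[simp]
theorem conv_nil_nil : conv ([] : List A) ([] : List B) = [] := rfl

@[simp]
theorem conv_cons_cons (a : A) (b : B) (u : List A) (v : List B) :
    conv (a :: u) (b :: v) = (some a, some b) :: conv u v := by
  simp [conv, Nat.succ_max_succ, List.range_succ_eq_map, Function.comp_def]

@[simp]
theorem conv_cons_nil (a : A) (u : List A) :
    conv (a :: u) ([] : List B) = (some a, none) :: conv u [] := by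
  simp [conv, List.range_succ_eq_map, Function.comp_def]

@[simp]
theorem conv_nil_cons (b : B) (v : List B) :
    conv ([] : List A) (b :: v) = (none, some b) :: conv [] v := by
  simp [conv, List.range_succ_eq_map, Function.comp_def]

theorem getElem?_conv_bind_fst (u : List A) (v : List B) (i : ℕ) :
    (conv u v)[i]?.bind Prod.fst = u[i]? := by
  by_cases h : i < max u.length v.length
  · simp [conv, List.getElem?_range h]
  · have h' : u.length ≤ i := (le_max_left _ _).trans (not_lt.1 h)
    rw [List.getElem?_eq_none (by simpa [conv] using h), List.getElem?_eq_none h']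
    rfl

theorem filterMap_fst_conv (u : List A) (v : List B) : (conv u v).filterMap Prod.fst = u := by
  induction u generalizing v with
  | nil =>
    induction v with
    | nil => rfl
    | cons b v ih => simpa using ih
  | cons a u ih => cases v <;> simp [ih]

theorem filterMap_snd_conv (u : List A) (v : List B) : (conv u v).filterMap Prod.snd = v := by
  induction u generalizing v with
  | nil =>
    induction v with
    | nil => rfl
    | cons b v ih => simpa using ih
  | cons a u ih => cases v <;> simp [ih]

/-- A predicate on pairs of padded letters holds along a convolution if and only if it holds at
all positions, provided it holds for the pair of padding symbols. -/
theorem forall_mem_conv_iff (p : Option A → Option B → Prop) (hp : p none none) (u : List A)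
    (v : List B) : (∀ l ∈ conv u v, p l.1 l.2) ↔ ∀ i : ℕ, p u[i]? v[i]? := by
  constructor
  · intro h i
    by_cases hi : i < max u.length v.length
    · exact h (u[i]?, v[i]?) (List.mem_map.2 ⟨i, List.mem_range.2 hi, rfl⟩)
    · rw [not_lt, max_le_iff] at hi
      rwa [List.getElem?_eq_none hi.1, List.getElem?_eq_none hi.2]
  · intro h l hl
    obtain ⟨i, -, rfl⟩ := List.mem_map.1 hl
    exact h i

/-- The relation between the letters at two successive positions of a convolution: padding is
followed by padding. -/
def PadStep (x y : Option A × Option B) : Prop :=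
  (x.1 = none → y.1 = none) ∧ (x.2 = none → y.2 = none)

theorem isChain_padStep_iff_pairwise (w : List (Option A × Option B)) :
    w.IsChain PadStep ↔ w.Pairwise PadStep := by
  have : Trans (PadStep (A := A) (B := B)) PadStep PadStep :=
    ⟨fun h h' => ⟨fun e => h'.1 (h.1 e), fun e => h'.2 (h.2 e)⟩⟩
  exact List.isChain_iff_pairwise

theorem pairwise_padStep_conv (u : List A) (v : List B) : (conv u v).Pairwise PadStep := by
  rw [conv, List.pairwise_map]
  refine List.pairwise_lt_range.imp fun {i j} h => ⟨?_, ?_⟩ <;>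
  · simp only [List.getElem?_eq_none_iff]
    omega

theorem ne_none_of_mem_conv (u : List A) (v : List B) : ∀ l ∈ conv u v, l ≠ (none, none) := by
  intro l hl
  obtain ⟨i, hi, rfl⟩ := List.mem_map.1 hl
  rw [List.mem_range] at hi
  simp only [ne_eq, Prod.mk.injEq, List.getElem?_eq_none_iff]
  omega

theorem eq_conv_filterMap (w : List (Option A × Option B)) (hw : w.Pairwise PadStep)
    (hne : ∀ l ∈ w, l ≠ (none, none)) : w = conv (w.filterMap Prod.fst) (w.filterMap Prod.snd) := by
  induction w with
  | nil => rfl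
  | cons l w ih =>
    rw [List.pairwise_cons] at hw
    have ih' := ih hw.2 fun l hl => hne l (List.mem_cons_of_mem _ hl)
    obtain ⟨_ | a, _ | b⟩ := l
    · exact absurd rfl (hne _ List.mem_cons_self)
    · have h0 : w.filterMap Prod.fst = [] :=
        List.filterMap_eq_nil_iff.2 fun l hl => (hw.1 l hl).1 rfl
      rw [h0] at ih'
      simp [h0, ← ih']
    · have h0 : w.filterMap Prod.snd = [] :=
        List.filterMap_eq_nil_iff.2 fun l hl => (hw.1 l hl).2 rfl
      rw [h0] at ih'
      simp [h0, ← ih']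
    · simp [← ih']

/-- The convolutions of the words of two regular languages form a regular language. -/
theorem isRegular_conv [Fintype A] [Fintype B] {K : Language A} {K' : Language B}
    (hK : K.IsRegular) (hK' : K'.IsRegular) :
    Language.IsRegular ({w | ∃ u ∈ K, ∃ v ∈ K', w = conv u v} : Language (Option A × Option B)) := by
  refine Eq.subst (motive := Language.IsRegular) (Set.ext fun w => ?_)
    (((isRegular_isChain PadStep).inf (isRegular_forall_mem (· ≠ (none, none)))).inf
      ((isRegular_filterMap_preimage hK Prod.fst).inf (isRegular_filterMap_preimage hK' Prod.snd)))
  change (w.IsChain PadStep ∧ _) ∧ w.filterMap Prod.fst ∈ K ∧ w.filterMap Prod.snd ∈ K' ↔ _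
  rw [isChain_padStep_iff_pairwise]
  constructor
  · rintro ⟨⟨h1, h2⟩, h3, h4⟩
    exact ⟨_, h3, _, h4, eq_conv_filterMap w h1 h2⟩
  · rintro ⟨u, hu, v, hv, rfl⟩
    rw [filterMap_fst_conv, filterMap_snd_conv]
    exact ⟨⟨pairwise_padStep_conv u v, ne_none_of_mem_conv u v⟩, hu, hv⟩

theorem sum_map_elim {α β M : Type} [AddMonoid M] (p : α → Option β) (g : β → M) (w : List α) :
    (w.map fun l => (p l).elim 0 g).sum = ((w.filterMap p).map g).sum := by
  induction w with
  | nil => rfl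
  | cons l w ih => cases h : p l <;> simp [h, ih]

end Convolution

section NormalForm

variable {m n : ℕ}

/-- The exponent of the power of `a` which can be moved from the left to the right of `t`
(for `e = true`) or `t⁻¹` (for `e = false`). -/
def bsDeg (m n : ℕ) (e : Bool) : ℕ := if e then n else m

/-- Reduced stacks. The letter `(e, r)` stands for `aʳ t` or `aʳ t⁻¹`, depending on `e`, and the
last letter of the product comes first. -/
def BSRed (m n : ℕ) (P : List (Bool × Fin n)) : Prop :=
  P.IsChain (fun x y => (x.2 : ℕ) = 0 → x.1 = y.1) ∧ ∀ x ∈ P, (x.2 : ℕ) < bsDeg m n x.1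

/-- Britton normal forms: a reduced stack followed by a power of `a`. -/
abbrev BSForm (m n : ℕ) : Type := {s : List (Bool × Fin n) × ℤ // BSRed m n s.1}

/-- The relation between the normal form of a group element and that of its product with `t`
(for `e = true`) or `t⁻¹` (for `e = false`). -/
def BSStep (m n : ℕ) (e : Bool) (s s' : List (Bool × Fin n) × ℤ) : Prop :=
  ∃ (x : Bool × Fin n) (q : ℤ),
    (x.1 = e ∧ s'.1 = x :: s.1 ∧ s.2 = bsDeg m n e * q + (x.2 : ℕ) ∧ s'.2 = bsDeg m n (!e) * q) ∨
    (x.1 = !e ∧ s.1 = x :: s'.1 ∧ s.2 = bsDeg m n e * q ∧ s'.2 = bsDeg m n (!e) * q + (x.2 : ℕ))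

theorem BSStep.symm {e : Bool} {s s' : List (Bool × Fin n) × ℤ} (h : BSStep m n e s s') :
    BSStep m n (!e) s' s := by
  obtain ⟨x, q, ⟨h1, h2, h3, h4⟩ | ⟨h1, h2, h3, h4⟩⟩ := h
  · exact ⟨x, q, Or.inr ⟨by simpa using h1, h2, h4, by simpa using h3⟩⟩
  · exact ⟨x, q, Or.inl ⟨h1, h2, h4, by simpa using h3⟩⟩

theorem BSStep.add {e : Bool} {s s' : List (Bool × Fin n) × ℤ} (h : BSStep m n e s s') :
    BSStep m n e (s.1, s.2 + bsDeg m n e) (s'.1, s'.2 + bsDeg m n (!e)) := by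
  obtain ⟨x, q, ⟨h1, h2, h3, h4⟩ | ⟨h1, h2, h3, h4⟩⟩ := h
  · exact ⟨x, q + 1, Or.inl ⟨h1, h2, by simp only [h3]; ring, by simp only [h4]; ring⟩⟩
  · exact ⟨x, q + 1, Or.inr ⟨h1, h2, by simp only [h3]; ring, by simp only [h4]; ring⟩⟩

theorem bsDeg_pos (hm : 0 < m) (hmn : m < n) (e : Bool) : 0 < bsDeg m n e := by
  cases e <;> simp [bsDeg] <;> omega

theorem bsDeg_le (hmn : m < n) (e : Bool) : bsDeg m n e ≤ n := by
  cases e <;> simp [bsDeg]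
  omega

theorem eq_and_eq_of_mul_add_eq {d : ℕ} {q q' : ℤ} {r r' : ℕ} (hr : r < d) (hr' : r' < d)
    (h : (d : ℤ) * q + r = d * q' + r') : q = q' ∧ r = r' := by
  have hd : (0 : ℤ) < d := by omega
  have hq : q = q' := by
    have h1 : q < q' + 1 := by
      by_contra hc
      nlinarith
    have h2 : q' < q + 1 := by
      by_contra hc
      nlinarith
    omega
  subst hq
  exact ⟨rfl, by omega⟩

theorem BSStep.unique (hm : 0 < m) (hmn : m < n) {e : Bool} {s s' s'' : List (Bool × Fin n) × ℤ}
    (hr : BSRed m n s'.1) (hr' : BSRed m n s''.1)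
    (h : BSStep m n e s s') (h' : BSStep m n e s s'') : s' = s'' := by
  have hd := bsDeg_pos hm hmn e
  have mixed : ∀ {t t' : List (Bool × Fin n) × ℤ} {x y : Bool × Fin n} {q q' : ℤ},
      BSRed m n t.1 → x.1 = e → t.1 = x :: s.1 → s.2 = bsDeg m n e * q + (x.2 : ℕ) →
      y.1 = !e → s.1 = y :: t'.1 → s.2 = bsDeg m n e * q' → False := by
    intro t t' x y q q' ht h1 h2 h3 k1 k2 k3
    rw [h2] at ht
    have hx : (x.2 : ℕ) < bsDeg m n e := h1 ▸ ht.2 x List.mem_cons_self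
    have hz := (eq_and_eq_of_mul_add_eq (q := q) (q' := q') hx hd (by
      rw [← h3, k3]; simp)).2
    have hc := ht.1
    rw [k2, List.isChain_cons_cons] at hc
    have := hc.1 hz
    rw [h1, k1] at this
    cases e <;> simp at this
  obtain ⟨x, q, ⟨h1, h2, h3, h4⟩ | ⟨h1, h2, h3, h4⟩⟩ := h <;>
    obtain ⟨y, q', ⟨k1, k2, k3, k4⟩ | ⟨k1, k2, k3, k4⟩⟩ := h'
  · rw [h2] at hr
    rw [k2] at hr'
    have hx : (x.2 : ℕ) < bsDeg m n e := h1 ▸ hr.2 x List.mem_cons_self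
    have hy : (y.2 : ℕ) < bsDeg m n e := k1 ▸ hr'.2 y List.mem_cons_self
    obtain ⟨rfl, hxy⟩ := eq_and_eq_of_mul_add_eq hx hy (h3.symm.trans k3)
    have : x = y := Prod.ext (h1.trans k1.symm) (Fin.ext hxy)
    exact Prod.ext (by rw [h2, k2, this]) (by rw [h4, k4])
  · exact (mixed hr h1 h2 h3 k1 k2 k3).elim
  · exact (mixed hr' k1 k2 k3 h1 h2 h3).elim
  · obtain ⟨hxy, hP⟩ := List.cons.inj (h2.symm.trans k2)
    have hq : q = q' := mul_left_cancel₀ (by exact_mod_cast hd.ne') (h3.symm.trans k3)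
    exact Prod.ext hP (by rw [h4, k4, hxy, hq])

theorem BSStep.form_unique (hm : 0 < m) (hmn : m < n) {e : Bool} {s : List (Bool × Fin n) × ℤ}
    {s' s'' : BSForm m n} (h : BSStep m n e s s'.1) (h' : BSStep m n e s s''.1) : s' = s'' :=
  Subtype.ext (BSStep.unique hm hmn s'.2 s''.2 h h')

theorem BSStep.exists (hm : 0 < m) (hmn : m < n) (e : Bool) (s : BSForm m n) :
    ∃ s' : BSForm m n, BSStep m n e s.1 s'.1 := by
  obtain ⟨⟨P, N⟩, hP⟩ := s
  have hd := bsDeg_pos hm hmn e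
  have hdn := bsDeg_le hmn e
  have hN := Int.mul_ediv_add_emod N (bsDeg m n e)
  have h0 := Int.emod_nonneg N (b := bsDeg m n e) (by omega)
  have h1 := Int.emod_lt_of_pos N (b := bsDeg m n e) (by omega)
  obtain ⟨r, hr⟩ := Int.eq_ofNat_of_zero_le h0
  by_cases hpop : ∃ y P', P = y :: P' ∧ y.1 = (!e) ∧ r = 0
  · obtain ⟨y, P', rfl, hy, rfl⟩ := hpop
    refine ⟨⟨(P', bsDeg m n (!e) * (N / bsDeg m n e) + (y.2 : ℕ)), ?_⟩, y, N / bsDeg m n e,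
      Or.inr ⟨hy, rfl, ?_, rfl⟩⟩
    · exact ⟨hP.1.tail, fun x hx => hP.2 x (List.mem_cons_of_mem _ hx)⟩
    · simp only
      omega
  · have hrn : r < bsDeg m n e := by omega
    refine ⟨⟨((e, ⟨r, by omega⟩) :: P, bsDeg m n (!e) * (N / bsDeg m n e)), ?_⟩,
      (e, ⟨r, by omega⟩), N / bsDeg m n e, Or.inl ⟨rfl, rfl, ?_, rfl⟩⟩
    · refine ⟨hP.1.cons ?_, ?_⟩
      · intro y hy hr0
        by_contra hne
        obtain ⟨P', hP'⟩ := List.head?_eq_some_iff.1 hy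
        exact hpop ⟨y, P', hP', by revert hne; cases e <;> cases y.1 <;> simp, hr0⟩
      · intro x hx
        rcases List.mem_cons.1 hx with rfl | hx
        · exact hrn
        · exact hP.2 x hx
    · simp only
      omega

/-- Right multiplication by `a` on normal forms. -/
def bsPermA (m n : ℕ) : Equiv.Perm (BSForm m n) where
  toFun s := ⟨(s.1.1, s.1.2 + 1), s.2⟩
  invFun s := ⟨(s.1.1, s.1.2 - 1), s.2⟩
  left_inv s := Subtype.ext (by simp)
  right_inv s := Subtype.ext (by simp)

theorem bsPermA_zpow (k : ℤ) (s : BSForm m n) :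
    (bsPermA m n ^ k) s = ⟨(s.1.1, s.1.2 + k), s.2⟩ := by
  induction k with
  | zero => exact Subtype.ext (by simp)
  | succ k ih =>
    rw [add_comm, zpow_add, zpow_one, Equiv.Perm.mul_apply, ih]
    exact Subtype.ext (Prod.ext rfl (by
      change s.1.2 + k + 1 = s.1.2 + (1 + k); ring))
  | pred k ih =>
    rw [sub_eq_neg_add, zpow_add, zpow_neg_one, Equiv.Perm.mul_apply, ih]
    exact Subtype.ext (Prod.ext rfl (by
      change s.1.2 + -k - 1 = s.1.2 + (-1 + -k); ring))

/-- Right multiplication by `t` on normal forms. -/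
noncomputable def bsPermT (hm : 0 < m) (hmn : m < n) : Equiv.Perm (BSForm m n) where
  toFun s := (BSStep.exists hm hmn true s).choose
  invFun s := (BSStep.exists hm hmn false s).choose
  left_inv s := BSStep.form_unique hm hmn
    (BSStep.exists hm hmn false _).choose_spec (BSStep.exists hm hmn true s).choose_spec.symm
  right_inv s := BSStep.form_unique hm hmn
    (BSStep.exists hm hmn true _).choose_spec (BSStep.exists hm hmn false s).choose_spec.symm

theorem bsStep_bsPermT (hm : 0 < m) (hmn : m < n) (s : BSForm m n) :
    BSStep m n true s.1 (bsPermT hm hmn s).1 := (BSStep.exists hm hmn true s).choose_spec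

theorem bsStep_bsPermT_inv (hm : 0 < m) (hmn : m < n) (s : BSForm m n) :
    BSStep m n false s.1 ((bsPermT hm hmn)⁻¹ s).1 := (BSStep.exists hm hmn false s).choose_spec

theorem bsPermT_mul_bsPermA_pow (hm : 0 < m) (hmn : m < n) :
    bsPermT hm hmn * bsPermA m n ^ n = bsPermA m n ^ m * bsPermT hm hmn := by
  ext s : 1
  have h1 := bsStep_bsPermT hm hmn ((bsPermA m n ^ n) s)
  have h2 := (bsStep_bsPermT hm hmn s).add
  have h3 := bsPermA_zpow (n : ℤ) s
  have h4 := bsPermA_zpow (m : ℤ) (bsPermT hm hmn s)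
  rw [zpow_natCast] at h3 h4
  rw [Equiv.Perm.mul_apply, Equiv.Perm.mul_apply, h4]
  rw [h3] at h1 ⊢
  exact BSStep.form_unique hm hmn h1 h2

/-- The action of `BS m n` on normal forms: `g` acts as right multiplication by `g⁻¹`. -/
noncomputable def bsAct (hm : 0 < m) (hmn : m < n) : BS m n →* Equiv.Perm (BSForm m n) :=
  PresentedGroup.toGroup (f := ![(bsPermA m n)⁻¹, (bsPermT hm hmn)⁻¹]) (by
    rintro r rfl
    have h := bsPermT_mul_bsPermA_pow hm hmn
    simp only [map_mul, map_pow, map_inv, FreeGroup.lift_apply_of, Matrix.cons_val_zero,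
      Matrix.cons_val_one, inv_pow, inv_inv]
    rw [mul_assoc, h]
    group)

theorem bsAct_bsA (hm : 0 < m) (hmn : m < n) : bsAct hm hmn (bsA m n) = (bsPermA m n)⁻¹ :=
  PresentedGroup.toGroup.of _

theorem bsAct_bsT (hm : 0 < m) (hmn : m < n) : bsAct hm hmn (bsT m n) = (bsPermT hm hmn)⁻¹ :=
  PresentedGroup.toGroup.of _

/-- The generator `t` or its inverse. -/
def bsTPow (m n : ℕ) (e : Bool) : BS m n := if e then bsT m n else (bsT m n)⁻¹

/-- The group element represented by a letter of a stack. -/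
def bsLetter (m n : ℕ) (x : Bool × Fin n) : BS m n := bsA m n ^ (x.2 : ℕ) * bsTPow m n x.1

/-- The group element represented by a normal form. -/
def bsVal (m n : ℕ) (s : List (Bool × Fin n) × ℤ) : BS m n :=
  (s.1.reverse.map (bsLetter m n)).prod * bsA m n ^ s.2

theorem bsTPow_not (e : Bool) : bsTPow m n (!e) = (bsTPow m n e)⁻¹ := by
  cases e <;> simp [bsTPow]

theorem bsT_mul_bsA_pow : bsT m n * bsA m n ^ m = bsA m n ^ n * bsT m n := by
  have h : PresentedGroup.mk (bsRel m n) (FreeGroup.of 1 * FreeGroup.of 0 ^ m *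
      (FreeGroup.of 1)⁻¹ * (FreeGroup.of 0 ^ n)⁻¹) = 1 := PresentedGroup.one_of_mem rfl
  simp only [map_mul, map_pow, map_inv] at h
  exact mul_inv_eq_iff_eq_mul.1 (mul_inv_eq_one.1 h)

theorem bsA_zpow_mul_bsTPow (e : Bool) (q : ℤ) :
    bsA m n ^ (bsDeg m n e * q) * bsTPow m n e = bsTPow m n e * bsA m n ^ (bsDeg m n (!e) * q) := by
  have h : SemiconjBy (bsT m n) (bsA m n ^ m) (bsA m n ^ n) := bsT_mul_bsA_pow
  cases e
  · have := (h.inv_symm_left).zpow_right q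
    simpa [bsDeg, bsTPow, zpow_mul, zpow_natCast] using this.symm
  · simpa [bsDeg, bsTPow, zpow_mul, zpow_natCast] using (h.zpow_right q).symm

theorem bsVal_cons (x : Bool × Fin n) (P : List (Bool × Fin n)) (N : ℤ) :
    bsVal m n (x :: P, N) = bsVal m n (P, (x.2 : ℕ)) * bsTPow m n x.1 * bsA m n ^ N := by
  simp [bsVal, bsLetter, mul_assoc]

theorem bsVal_add (P : List (Bool × Fin n)) (N k : ℤ) :
    bsVal m n (P, N + k) = bsVal m n (P, N) * bsA m n ^ k := by
  simp [bsVal, zpow_add, mul_assoc]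

theorem BSStep.bsVal_mul {e : Bool} {s s' : List (Bool × Fin n) × ℤ} (h : BSStep m n e s s') :
    bsVal m n s * bsTPow m n e = bsVal m n s' := by
  have push : ∀ {e : Bool} {s s' : List (Bool × Fin n) × ℤ} {x : Bool × Fin n} {q : ℤ},
      x.1 = e → s'.1 = x :: s.1 → s.2 = bsDeg m n e * q + (x.2 : ℕ) →
      s'.2 = bsDeg m n (!e) * q → bsVal m n s * bsTPow m n e = bsVal m n s' := by
    rintro e ⟨P, N⟩ ⟨P', N'⟩ x q rfl h2 h3 h4
    simp only at h2 h3 h4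
    rw [h2, bsVal_cons, h4, h3, add_comm, bsVal_add, mul_assoc, bsA_zpow_mul_bsTPow, mul_assoc]
  obtain ⟨x, q, ⟨h1, h2, h3, h4⟩ | ⟨h1, h2, h3, h4⟩⟩ := h
  · exact push h1 h2 h3 h4
  · have := push (s := s') (s' := s) h1 h2 h4 (by simpa using h3)
    rw [← this, bsTPow_not, inv_mul_cancel_right]

theorem bsVal_bsAct (hm : 0 < m) (hmn : m < n) (g : BS m n) (s : BSForm m n) :
    bsVal m n (bsAct hm hmn g s).1 = bsVal m n s.1 * g⁻¹ := by
  let H : Subgroup (BS m n) :=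
    { carrier := {g | ∀ s : BSForm m n, bsVal m n (bsAct hm hmn g s).1 = bsVal m n s.1 * g⁻¹}
      one_mem' := by simp
      mul_mem' := by
        intro g h hg hh s
        rw [map_mul, Equiv.Perm.mul_apply, hg, hh, mul_inv_rev, mul_assoc]
      inv_mem' := by
        intro g hg s
        have := hg (bsAct hm hmn g⁻¹ s)
        rw [← Equiv.Perm.mul_apply, ← map_mul, mul_inv_cancel, map_one, Equiv.Perm.one_apply] at this
        rw [this, inv_inv, inv_mul_cancel_right] }
  refine PresentedGroup.generated_by (bsRel m n) H (fun i => ?_) g s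
  fin_cases i
  · intro s
    change bsVal m n (bsAct hm hmn (bsA m n) s).1 = bsVal m n s.1 * (bsA m n)⁻¹
    rw [bsAct_bsA, ← zpow_neg_one, bsPermA_zpow, bsVal_add, zpow_neg_one]
  · intro s
    change bsVal m n (bsAct hm hmn (bsT m n) s).1 = bsVal m n s.1 * (bsT m n)⁻¹
    rw [bsAct_bsT]
    exact (bsStep_bsPermT_inv hm hmn s).bsVal_mul.symm

theorem bsStep_bsAct_bsTPow_inv (hm : 0 < m) (hmn : m < n) (e : Bool) (s : BSForm m n) :
    BSStep m n e s.1 (bsAct hm hmn (bsTPow m n e)⁻¹ s).1 := by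
  cases e
  · simpa [bsTPow, bsAct_bsT] using bsStep_bsPermT_inv hm hmn s
  · simpa [bsTPow, bsAct_bsT] using bsStep_bsPermT hm hmn s

theorem bsAct_bsA_zpow_inv (hm : 0 < m) (hmn : m < n) (k : ℤ) (s : BSForm m n) :
    bsAct hm hmn (bsA m n ^ k)⁻¹ s = ⟨(s.1.1, s.1.2 + k), s.2⟩ := by
  rw [map_inv, map_zpow, bsAct_bsA, inv_zpow, inv_inv, bsPermA_zpow]

/-- The normal form of the identity. -/
def bsFormOne (m n : ℕ) : BSForm m n := ⟨([], 0), List.isChain_nil, by simp⟩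

theorem bsAct_bsVal_inv (hm : 0 < m) (hmn : m < n) (P : List (Bool × Fin n)) (N : ℤ)
    (h : BSRed m n P) :
    bsAct hm hmn (bsVal m n (P, N))⁻¹ (bsFormOne m n) = ⟨(P, N), h⟩ := by
  induction P generalizing N with
  | nil =>
    have : bsVal m n (([] : List (Bool × Fin n)), N) = bsA m n ^ N := by simp [bsVal]
    rw [this, bsAct_bsA_zpow_inv]
    exact Subtype.ext (by simp [bsFormOne])
  | cons x P ih =>
    have hP : BSRed m n P := ⟨h.1.tail, fun y hy => h.2 y (List.mem_cons_of_mem _ hy)⟩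
    have hs := bsStep_bsAct_bsTPow_inv hm hmn x.1 ⟨(P, (x.2 : ℕ)), hP⟩
    have hx : bsAct hm hmn (bsTPow m n x.1)⁻¹ ⟨(P, (x.2 : ℕ)), hP⟩ = ⟨(x :: P, 0), h⟩ :=
      BSStep.form_unique hm hmn hs ⟨x, 0, Or.inl ⟨rfl, rfl, by simp, by simp⟩⟩
    rw [bsVal_cons, mul_inv_rev, mul_inv_rev, map_mul, Equiv.Perm.mul_apply, map_mul,
      Equiv.Perm.mul_apply, ih _ hP, hx, bsAct_bsA_zpow_inv]
    exact Subtype.ext (by simp)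

theorem bsVal_injective (hm : 0 < m) (hmn : m < n) {s s' : BSForm m n}
    (h : bsVal m n s.1 = bsVal m n s'.1) : s = s' :=
  (bsAct_bsVal_inv hm hmn s.1.1 s.1.2 s.2).symm.trans
    ((congrArg (fun g => bsAct hm hmn g⁻¹ (bsFormOne m n)) h).trans
      (bsAct_bsVal_inv hm hmn s'.1.1 s'.1.2 s'.2))

theorem bsVal_surjective (hm : 0 < m) (hmn : m < n) (g : BS m n) :
    ∃ s : BSForm m n, bsVal m n s.1 = g :=
  ⟨bsAct hm hmn g⁻¹ (bsFormOne m n), by rw [bsVal_bsAct]; simp [bsVal, bsFormOne]⟩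

theorem bsVal_mul_bsTPow_eq_iff (hm : 0 < m) (hmn : m < n) (e : Bool) (s s' : BSForm m n) :
    bsVal m n s.1 * bsTPow m n e = bsVal m n s'.1 ↔ BSStep m n e s.1 s'.1 := by
  refine ⟨fun h => ?_, BSStep.bsVal_mul⟩
  have hs := bsStep_bsAct_bsTPow_inv hm hmn e s
  rwa [bsVal_injective hm hmn (hs.bsVal_mul.symm.trans h)] at hs

theorem bsVal_mul_bsA_zpow_eq_iff (hm : 0 < m) (hmn : m < n) (k : ℤ) (s s' : BSForm m n) :
    bsVal m n s.1 * bsA m n ^ k = bsVal m n s'.1 ↔ s.1.1 = s'.1.1 ∧ s'.1.2 = s.1.2 + k := by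
  rw [← bsVal_add]
  constructor
  · intro h
    have := bsVal_injective hm hmn (s := ⟨(s.1.1, s.1.2 + k), s.2⟩) h
    rw [← this]
    exact ⟨rfl, rfl⟩
  · rintro ⟨h1, h2⟩
    rw [h1, ← h2]

end NormalForm

section Encoding

variable {m n : ℕ}

/-- The integer represented by a letter of a unary expansion. -/
def unarySign (b : Bool) : ℤ := if b then 1 else -1

/-- The unary expansion of an integer. -/
def unary (N : ℤ) : List Bool := List.replicate N.natAbs (decide (0 ≤ N))

theorem sum_unary (N : ℤ) : ((unary N).map unarySign).sum = N := by
  rcases le_or_gt 0 N with h | h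
  · simp [unary, unarySign, h, abs_of_nonneg h]
  · simp [unary, unarySign, not_le.2 h, abs_of_neg h]

theorem isChain_unary (N : ℤ) : (unary N).IsChain (· = ·) :=
  List.isChain_replicate_of_rel _ rfl

theorem exists_eq_unary {v : List Bool} (hv : v.IsChain (· = ·)) : ∃ N, v = unary N := by
  cases v with
  | nil => exact ⟨0, rfl⟩
  | cons b v =>
    have hb : b :: v = List.replicate (v.length + 1) b := by
      refine List.eq_replicate_iff.2 ⟨rfl, fun c hc => ?_⟩
      rcases List.mem_cons.1 hc with rfl | hc
      · rfl
      · exact (hv.rel_cons hc).symm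
    rw [hb]
    cases b
    · refine ⟨-(v.length + 1 : ℕ), ?_⟩
      have : ¬ (0 : ℤ) ≤ -(v.length + 1 : ℕ) := by omega
      rw [unary, decide_eq_false this, Int.natAbs_neg, Int.natAbs_natCast]
    · refine ⟨(v.length + 1 : ℕ), ?_⟩
      rw [unary, decide_eq_true (by omega), Int.natAbs_natCast]

/-- The alphabet of the normal form. Its letters carry a letter of the stack on a first track and
a letter of the unary expansion of the exponent of `a` on a second one. -/
abbrev BSAlphabet (n : ℕ) : Type := Option (Bool × Fin n) × Option Bool

/-- The word over `BSAlphabet n` representing a normal form. -/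
def bsEnc (s : List (Bool × Fin n) × ℤ) : List (BSAlphabet n) := conv s.1.reverse (unary s.2)

/-- The language of all words representing normal forms. -/
def bsLang (m n : ℕ) : Language (BSAlphabet n) := {w | ∃ s : BSForm m n, w = bsEnc s.1}

/-- The group element represented by a word over `BSAlphabet n`. -/
def bsEval (m n : ℕ) (w : List (BSAlphabet n)) : BS m n :=
  ((w.filterMap Prod.fst).map (bsLetter m n)).prod *
    bsA m n ^ ((w.filterMap Prod.snd).map unarySign).sum

theorem bsEval_bsEnc (s : List (Bool × Fin n) × ℤ) : bsEval m n (bsEnc s) = bsVal m n s := by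
  rw [bsEval, bsEnc, filterMap_fst_conv, filterMap_snd_conv, sum_unary, bsVal]

theorem isRegular_bsLang (m n : ℕ) : (bsLang m n).IsRegular := by
  refine Eq.subst (motive := Language.IsRegular) (Set.ext fun w => ?_)
    (isRegular_conv ((isRegular_isChain
      (fun y x : Bool × Fin n => (x.2 : ℕ) = 0 → x.1 = y.1)).inf
        (isRegular_forall_mem fun x => (x.2 : ℕ) < bsDeg m n x.1))
      (isRegular_isChain fun b c : Bool => b = c))
  constructor
  · rintro ⟨u, hu, v, hv, rfl⟩
    obtain ⟨N, rfl⟩ := exists_eq_unary hv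
    refine ⟨⟨(u.reverse, N), List.isChain_reverse.2 hu.1, ?_⟩, by simp [bsEnc]⟩
    intro x hx
    exact hu.2 x (List.mem_reverse.1 hx)
  · rintro ⟨s, rfl⟩
    refine ⟨_, ⟨List.isChain_reverse.2 s.2.1, fun x hx => ?_⟩, _, isChain_unary _, rfl⟩
    exact s.2.2 x (List.mem_reverse.1 hx)

theorem bijOn_bsEval (hm : 0 < m) (hmn : m < n) :
    Set.BijOn (bsEval m n) (bsLang m n) Set.univ := by
  refine ⟨fun _ _ => Set.mem_univ _, ?_, ?_⟩
  · rintro _ ⟨s, rfl⟩ _ ⟨s', rfl⟩ h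
    rw [bsEval_bsEnc, bsEval_bsEnc] at h
    rw [bsVal_injective hm hmn h]
  · intro g _
    obtain ⟨s, hs⟩ := bsVal_surjective hm hmn g
    exact ⟨bsEnc s.1, ⟨s, rfl⟩, by rw [bsEval_bsEnc, hs]⟩

/-- The contribution of a padded letter to the exponent of `a`. -/
def expWeight (o : Option (BSAlphabet n)) : ℤ := (o.bind Prod.snd).elim 0 unarySign

/-- The contribution of a padded letter to the height of the stack. -/
def heightWeight (o : Option (BSAlphabet n)) : ℤ := (o.bind Prod.fst).elim 0 fun _ => 1

theorem sum_expWeight {α : Type} (p : α → Option (BSAlphabet n)) (w : List α)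
    {s : List (Bool × Fin n) × ℤ} (h : w.filterMap p = bsEnc s) :
    (w.map fun l => expWeight (p l)).sum = s.2 := by
  have := sum_map_elim (fun l => (p l).bind Prod.snd) unarySign w
  rwa [← List.filterMap_filterMap, h, bsEnc, filterMap_snd_conv, sum_unary] at this

theorem sum_heightWeight {α : Type} (p : α → Option (BSAlphabet n)) (w : List α)
    {s : List (Bool × Fin n) × ℤ} (h : w.filterMap p = bsEnc s) :
    (w.map fun l => heightWeight (p l)).sum = s.1.length := by
  have := sum_map_elim (fun l => (p l).bind Prod.fst) (fun _ => (1 : ℤ)) w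
  rw [← List.filterMap_filterMap, h, bsEnc, filterMap_fst_conv] at this
  simpa [heightWeight] using this

theorem list_sum_map_apply {α ι : Type} (wt : α → ι → ℤ) (w : List α) (i : ι) :
    (w.map wt).sum i = (w.map fun l => wt l i).sum := by
  induction w with
  | nil => rfl
  | cons a w ih => simp [ih]

theorem list_sum_map_mul_sub {α : Type} (c d : ℤ) (f g : α → ℤ) (w : List α) :
    (w.map fun l => c * f l - d * g l).sum = c * (w.map f).sum - d * (w.map g).sum := by
  induction w with
  | nil => simp
  | cons a w ih => simp only [List.map_cons, List.sum_cons, ih]; ring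

/-- The convolutions of two words representing normal forms. -/
def bsPairs (m n : ℕ) : Language (Option (BSAlphabet n) × Option (BSAlphabet n)) :=
  {w | ∃ u ∈ bsLang m n, ∃ v ∈ bsLang m n, w = conv u v}

theorem isRegular_bsPairs (m n : ℕ) : (bsPairs m n).IsRegular :=
  isRegular_conv (isRegular_bsLang m n) (isRegular_bsLang m n)

/-- The words of pairs of padded letters whose stack tracks are related by `p` letter by
letter. -/
def stackRel (p : Option (Bool × Fin n) → Option (Bool × Fin n) → Prop) :
    Language (Option (BSAlphabet n) × Option (BSAlphabet n)) :=
  {w | ∀ l ∈ w, p (l.1.bind Prod.fst) (l.2.bind Prod.fst)}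

theorem conv_mem_stackRel_iff {p : Option (Bool × Fin n) → Option (Bool × Fin n) → Prop}
    (hp : p none none) (s s' : List (Bool × Fin n) × ℤ) :
    conv (bsEnc s) (bsEnc s') ∈ stackRel p ↔
      ∀ i : ℕ, p s.1.reverse[i]? s'.1.reverse[i]? := by
  refine (forall_mem_conv_iff (fun a b => p (a.bind Prod.fst) (b.bind Prod.fst)) hp _ _).trans ?_
  simp only [bsEnc, getElem?_conv_bind_fst]

theorem blindDet_mult_bsA_zpow (hm : 0 < m) (hmn : m < n) (k : ℤ) :
    BlindDetAtMostThreeCounter (Mult (bsEval m n) (bsLang m n) (bsA m n ^ k)) := by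
  refine Eq.subst (motive := BlindDetAtMostThreeCounter) (Set.ext fun w => ?_)
    (blindDet_of_regular (ι := Unit) (k := 1) (by norm_num)
      (fun _ => bsPairs m n ⊓ stackRel (fun a b => a = b))
      (fun _ => (isRegular_bsPairs m n).inf (isRegular_forall_mem _))
      (fun l _ => 1 * expWeight l.2 - 1 * expWeight l.1) (fun _ _ => k) (fun _ _ _ _ _ _ => rfl))
  have key : ∀ s s' : BSForm m n,
      (conv (bsEnc s.1) (bsEnc s'.1) ∈ stackRel (n := n) (fun a b => a = b) ∧
        ((conv (bsEnc s.1) (bsEnc s'.1)).map fun l (_ : Fin 1) =>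
          1 * expWeight l.2 - 1 * expWeight l.1).sum = fun _ => k) ↔
      bsEval m n (bsEnc s.1) * bsA m n ^ k = bsEval m n (bsEnc s'.1) := by
    intro s s'
    rw [bsEval_bsEnc, bsEval_bsEnc, bsVal_mul_bsA_zpow_eq_iff hm hmn, conv_mem_stackRel_iff rfl,
      funext_iff, ← List.ext_getElem?_iff, List.reverse_inj]
    simp only [list_sum_map_apply, list_sum_map_mul_sub, sum_expWeight _ _ (filterMap_fst_conv _ _),
      sum_expWeight _ _ (filterMap_snd_conv _ _)]
    refine and_congr_right fun _ => ⟨fun h => ?_, fun h _ => ?_⟩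
    · have := h 0
      omega
    · omega
  constructor
  · rintro ⟨-, ⟨⟨_, ⟨s, rfl⟩, _, ⟨s', rfl⟩, rfl⟩, h⟩, hs⟩
    exact ⟨_, ⟨s, rfl⟩, _, ⟨s', rfl⟩, (key s s').1 ⟨h, hs⟩, rfl⟩
  · rintro ⟨_, ⟨s, rfl⟩, _, ⟨s', rfl⟩, h, rfl⟩
    obtain ⟨h1, h2⟩ := (key s s').2 h
    exact ⟨(), ⟨⟨_, ⟨s, rfl⟩, _, ⟨s', rfl⟩, rfl⟩, h1⟩, h2⟩

/-- A list is the extension of another one by the letter `x` if and only if it is one letter longer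
and differs from it only by having `x` in place of padding. -/
theorem eq_append_singleton_iff {α : Type} (u v : List α) (x : α) :
    ((∀ i : ℕ, u[i]? = v[i]? ∨ u[i]? = none ∧ v[i]? = some x) ∧ v.length = u.length + 1) ↔
      v = u ++ [x] := by
  constructor
  · rintro ⟨h, hl⟩
    refine List.ext_getElem? fun i => ?_
    rcases lt_trichotomy i u.length with hi | rfl | hi
    · rw [List.getElem?_append_left hi]
      rcases h i with h | h
      · exact h.symm
      · simp [hi] at h
    · rcases h u.length with h | h
      · have : v.length ≤ u.length := by simpa using h.symm
        omega
      · simpa using h.2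
    · rw [List.getElem?_eq_none (by omega), List.getElem?_eq_none (by simp; omega)]
  · rintro rfl
    refine ⟨fun i => ?_, by simp⟩
    rcases lt_trichotomy i u.length with hi | rfl | hi
    · exact Or.inl (List.getElem?_append_left hi).symm
    · simp
    · left
      rw [List.getElem?_eq_none (by omega), List.getElem?_eq_none (by simp; omega)]

/-- The relation between letters of stacks when the stack changes by pushing `x` (if `x.1 = e`) or
popping `x` (otherwise). -/
def pushPop (e : Bool) (x : Bool × Fin n) (a b : Option (Bool × Fin n)) : Prop :=
  a = b ∨ if x.1 = e then a = none ∧ b = some x else b = none ∧ a = some x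

/-- The weights of the letters, comparing the exponents of `a` and the heights of the stacks. -/
def stepWeight (m n : ℕ) (e : Bool) (l : Option (BSAlphabet n) × Option (BSAlphabet n)) :
    Fin 2 → ℤ :=
  ![bsDeg m n (!e) * expWeight l.1 - bsDeg m n e * expWeight l.2,
    1 * heightWeight l.2 - 1 * heightWeight l.1]

/-- The total weight required when the stack changes by pushing or popping `x`. -/
def stepTarget (m n : ℕ) (e : Bool) (x : Bool × Fin n) : Fin 2 → ℤ :=
  if x.1 = e then ![bsDeg m n (!e) * (x.2 : ℕ), 1] else ![-(bsDeg m n e * (x.2 : ℕ)), -1]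

/-- The regular part of the multiplier language of `t` or `t⁻¹`, for a stack which changes by
pushing or popping `x`. -/
def stepLang (m n : ℕ) (e : Bool) (x : Bool × Fin n) :
    Language (Option (BSAlphabet n) × Option (BSAlphabet n)) :=
  bsPairs m n ⊓ (stackRel (pushPop e x) ⊓
    {w | (w.map fun l => expWeight l.1).sum ≡ if x.1 = e then ((x.2 : ℕ) : ℤ) else 0
      [ZMOD bsDeg m n e]})

theorem isRegular_stepLang (hm : 0 < m) (hmn : m < n) (e : Bool) (x : Bool × Fin n) :
    (stepLang m n e x).IsRegular := by
  have : NeZero (bsDeg m n e) := ⟨(bsDeg_pos hm hmn e).ne'⟩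
  exact (isRegular_bsPairs m n).inf ((isRegular_forall_mem _).inf (isRegular_modEq _ _ _))

theorem sum_stepWeight_eq_iff (e : Bool) (s s' : List (Bool × Fin n) × ℤ) (c d : ℤ) :
    ((conv (bsEnc s) (bsEnc s')).map (stepWeight m n e)).sum = ![c, d] ↔
      bsDeg m n (!e) * s.2 - bsDeg m n e * s'.2 = c ∧ (s'.1.length : ℤ) - s.1.length = d := by
  rw [funext_iff, Fin.forall_fin_two]
  simp only [list_sum_map_apply, stepWeight, Matrix.cons_val_zero, Matrix.cons_val_one,
    list_sum_map_mul_sub,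
    sum_expWeight _ _ (filterMap_fst_conv (bsEnc s) (bsEnc s')),
    sum_expWeight _ _ (filterMap_snd_conv (bsEnc s) (bsEnc s')),
    sum_heightWeight _ _ (filterMap_fst_conv (bsEnc s) (bsEnc s')),
    sum_heightWeight _ _ (filterMap_snd_conv (bsEnc s) (bsEnc s'))]
  rw [one_mul, one_mul]

theorem stack_push_iff (P P' : List (Bool × Fin n)) (e : Bool) (x : Bool × Fin n) (hx : x.1 = e) :
    ((∀ i : ℕ, pushPop e x P.reverse[i]? P'.reverse[i]?) ∧ (P'.length : ℤ) - P.length = 1) ↔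
      P' = x :: P := by
  have := eq_append_singleton_iff P.reverse P'.reverse x
  rw [← List.reverse_cons, List.reverse_inj, List.length_reverse, List.length_reverse] at this
  rw [← this]
  simp only [pushPop, if_pos hx]
  exact and_congr_right fun _ => by omega

theorem stack_pop_iff (P P' : List (Bool × Fin n)) (e : Bool) (x : Bool × Fin n) (hx : x.1 ≠ e) :
    ((∀ i : ℕ, pushPop e x P.reverse[i]? P'.reverse[i]?) ∧ (P'.length : ℤ) - P.length = -1) ↔
      P = x :: P' := by
  have := eq_append_singleton_iff P'.reverse P.reverse x
  rw [← List.reverse_cons, List.reverse_inj, List.length_reverse, List.length_reverse] at this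
  rw [← this]
  simp only [pushPop, if_neg hx]
  exact and_congr (forall_congr' fun _ => or_congr_left eq_comm) (by omega)

theorem conv_mem_stepLang_iff (e : Bool) (x : Bool × Fin n) (s s' : BSForm m n) :
    (conv (bsEnc s.1) (bsEnc s'.1) ∈ stepLang m n e x ∧
      ((conv (bsEnc s.1) (bsEnc s'.1)).map (stepWeight m n e)).sum = stepTarget m n e x) ↔
    (x.1 = e ∧ s'.1.1 = x :: s.1.1 ∧ s.1.2 ≡ (x.2 : ℕ) [ZMOD bsDeg m n e] ∧
      bsDeg m n (!e) * s.1.2 - bsDeg m n e * s'.1.2 = bsDeg m n (!e) * (x.2 : ℕ)) ∨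
    (x.1 = !e ∧ s.1.1 = x :: s'.1.1 ∧ s.1.2 ≡ 0 [ZMOD bsDeg m n e] ∧
      bsDeg m n (!e) * s.1.2 - bsDeg m n e * s'.1.2 = -(bsDeg m n e * (x.2 : ℕ))) := by
  have hpair : conv (bsEnc s.1) (bsEnc s'.1) ∈ bsPairs m n :=
    ⟨_, ⟨s, rfl⟩, _, ⟨s', rfl⟩, rfl⟩
  have hmem : conv (bsEnc s.1) (bsEnc s'.1) ∈ stepLang m n e x ↔
      (∀ i : ℕ, pushPop e x s.1.1.reverse[i]? s'.1.1.reverse[i]?) ∧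
        s.1.2 ≡ if x.1 = e then ((x.2 : ℕ) : ℤ) else 0 [ZMOD bsDeg m n e] := by
    rw [← conv_mem_stackRel_iff (Or.inl rfl)]
    conv_rhs => rw [← sum_expWeight _ _ (filterMap_fst_conv (bsEnc s.1) (bsEnc s'.1))]
    exact ⟨fun h => h.2, fun h => ⟨hpair, h⟩⟩
  rw [hmem, stepTarget]
  by_cases hx : x.1 = e
  · have hx' : x.1 ≠ !e := by rw [hx]; cases e <;> simp
    rw [if_pos hx, if_pos hx, sum_stepWeight_eq_iff, ← stack_push_iff s.1.1 s'.1.1 e x hx]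
    tauto
  · have hx' : x.1 = !e := by revert hx; cases e <;> cases x.1 <;> simp
    rw [if_neg hx, if_neg hx, sum_stepWeight_eq_iff, ← stack_pop_iff s.1.1 s'.1.1 e x hx]
    tauto

theorem bsStep_iff_exists_stepLang (hm : 0 < m) (hmn : m < n) (e : Bool) (s s' : BSForm m n) :
    BSStep m n e s.1 s'.1 ↔ ∃ x, conv (bsEnc s.1) (bsEnc s'.1) ∈ stepLang m n e x ∧
      ((conv (bsEnc s.1) (bsEnc s'.1)).map (stepWeight m n e)).sum = stepTarget m n e x := by
  have hd : (bsDeg m n e : ℤ) ≠ 0 := by exact_mod_cast (bsDeg_pos hm hmn e).ne'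
  simp only [conv_mem_stepLang_iff]
  constructor
  · rintro ⟨x, q, ⟨h1, h2, h3, h4⟩ | ⟨h1, h2, h3, h4⟩⟩
    · refine ⟨x, Or.inl ⟨h1, h2, ?_, ?_⟩⟩
      · rw [h3, Int.modEq_iff_dvd]
        exact ⟨-q, by ring⟩
      · rw [h3, h4]
        ring
    · refine ⟨x, Or.inr ⟨h1, h2, ?_, ?_⟩⟩
      · rw [h3, Int.modEq_iff_dvd]
        exact ⟨-q, by ring⟩
      · rw [h3, h4]
        ring
  · rintro ⟨x, ⟨h1, h2, h3, h4⟩ | ⟨h1, h2, h3, h4⟩⟩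
    · obtain ⟨q, hq⟩ := Int.modEq_iff_dvd.1 h3.symm
      refine ⟨x, q, Or.inl ⟨h1, h2, by linarith, mul_left_cancel₀ hd ?_⟩⟩
      linear_combination bsDeg m n (!e) * hq - h4
    · obtain ⟨q, hq⟩ := Int.modEq_iff_dvd.1 h3.symm
      refine ⟨x, q, Or.inr ⟨h1, h2, by linarith, mul_left_cancel₀ hd ?_⟩⟩
      linear_combination bsDeg m n (!e) * hq - h4

theorem stepLang_unambiguous (e : Bool) (x y : Bool × Fin n)
    (w : List (Option (BSAlphabet n) × Option (BSAlphabet n))) (hx : w ∈ stepLang m n e x)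
    (hs : (w.map (stepWeight m n e)).sum = stepTarget m n e x) (hy : w ∈ stepLang m n e y) :
    y = x := by
  obtain ⟨_, ⟨s, rfl⟩, _, ⟨s', rfl⟩, rfl⟩ := hx.1
  have hy' := (conv_mem_stackRel_iff (Or.inl rfl) _ _).1 hy.2.1
  rcases (conv_mem_stepLang_iff e x s s').1 ⟨hx, hs⟩ with ⟨-, h, -⟩ | ⟨-, h, -⟩
  · have := hy' s.1.1.length
    rw [h] at this
    by_cases hye : y.1 = e <;> simp [pushPop, hye] at this
    exact this.symm
  · have := hy' s'.1.1.length
    rw [h] at this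
    by_cases hye : y.1 = e <;> simp [pushPop, hye] at this
    exact this.symm

theorem blindDet_mult_bsTPow (hm : 0 < m) (hmn : m < n) (e : Bool) :
    BlindDetAtMostThreeCounter (Mult (bsEval m n) (bsLang m n) (bsTPow m n e)) := by
  refine Eq.subst (motive := BlindDetAtMostThreeCounter) (Set.ext fun w => ?_)
    (blindDet_of_regular (ι := Bool × Fin n) (k := 2) (by norm_num) (stepLang m n e)
      (isRegular_stepLang hm hmn e) (stepWeight m n e) (stepTarget m n e)
      (fun w x y hx hs hy => by rw [stepLang_unambiguous e x y w hx hs hy]))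
  constructor
  · rintro ⟨x, hx, hs⟩
    obtain ⟨_, ⟨s, rfl⟩, _, ⟨s', rfl⟩, rfl⟩ := hx.1
    refine ⟨_, ⟨s, rfl⟩, _, ⟨s', rfl⟩, ?_, rfl⟩
    rw [bsEval_bsEnc, bsEval_bsEnc, bsVal_mul_bsTPow_eq_iff hm hmn,
      bsStep_iff_exists_stepLang hm hmn]
    exact ⟨x, hx, hs⟩
  · rintro ⟨_, ⟨s, rfl⟩, _, ⟨s', rfl⟩, h, rfl⟩
    rw [bsEval_bsEnc, bsEval_bsEnc, bsVal_mul_bsTPow_eq_iff hm hmn] at h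
    exact (bsStep_iff_exists_stepLang hm hmn e s s').1 h

theorem blindDet_of_isRegular {α : Type} [Fintype α] {K : Language α} (hK : K.IsRegular) :
    BlindDetAtMostThreeCounter K := by
  refine Eq.subst (motive := BlindDetAtMostThreeCounter) (Set.ext fun w => ?_)
    (blindDet_of_regular (ι := Unit) (k := 0) (by norm_num) (fun _ => K) (fun _ => hK)
      (fun _ => 0) (fun _ => 0) (fun _ _ _ _ _ _ => rfl))
  exact ⟨fun h => h.choose_spec.1, fun h => ⟨(), h, Subsingleton.elim _ _⟩⟩

end Encoding

/-- For `2 ≤ m < n`, the Baumslag–Solitar group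
`BS(m,n) = ⟨a,t ∣ t aᵐ t⁻¹ = aⁿ⟩` is blind deterministic `3`-counter-graph automatic:
there are a finite alphabet `Λ` and a normal form `L ⊆ Λ*` accepted by a deterministic
quasi-realtime blind counter automaton with at most `3` counters, such that for every
generator `x ∈ {a, a⁻¹, t, t⁻¹}` the multiplier language `L_x` is accepted by such an
automaton as well. -/
theorem BS_blind_det_three_counter_graph_automatic (m n : ℕ) (h2 : 2 ≤ m) (hmn : m < n) :
    ∃ (Λ : Type) (_ : Fintype Λ) (L : Language Λ) (nf : List Λ → BS m n),
      Set.BijOn nf L Set.univ ∧ BlindDetAtMostThreeCounter L ∧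
      ∀ x ∈ ({bsA m n, (bsA m n)⁻¹, bsT m n, (bsT m n)⁻¹} : Set (BS m n)),
        BlindDetAtMostThreeCounter (Mult nf L x) := by
  have hm : 0 < m := by omega
  refine ⟨BSAlphabet n, inferInstance, bsLang m n, bsEval m n, bijOn_bsEval hm hmn,
    blindDet_of_isRegular (isRegular_bsLang m n), ?_⟩
  rintro x (rfl | rfl | rfl | rfl)
  · simpa using blindDet_mult_bsA_zpow hm hmn 1
  · simpa using blindDet_mult_bsA_zpow hm hmn (-1)
  · exact blindDet_mult_bsTPow hm hmn true
  · exact blindDet_mult_bsTPow hm hmn false
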